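/- Consider the discrete-time quantum walk search on the n×n torus grid, n ≥ 3. Suppose the marked set M can be partitioned into disjoint pairs of adjacent vertices, i.e. there is a set P of pairs of vertices such that each pair in P consists of two adjacent grid vertices, the pairs are pairwise disjoint, and M is the union of the pairs. For each pair p ∈ P, let e_p and e_p′ denote the two basis states 'dart of the first vertex pointing to the second' and 'dart of the second vertex pointing to the first'. Then the state φ = a·Σ_{x,y,c}|x,y,c⟩ − 4a·Σ_{p∈P}(|e_p⟩ + |e_p′⟩), which has amplitude −3a on the two directions of each marked pair's shared edge and amplitude a everywhere else, satisfies U′φ = φ. -/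

import Mathlib

/-- Discrete-time quantum walk search on the `n × n` torus grid.
Basis states are `((x, y), c)` with coin directions `0 = ↑`, `1 = ↓`, `2 = ←`, `3 = →`.
`flip` sends a dart to the reversed dart at the adjacent vertex (flip-flop structure). -/
noncomputable def GridWalk.flip (n : ℕ) [NeZero n] (e : (Fin n × Fin n) × Fin 4) :
    (Fin n × Fin n) × Fin 4 :=
  if e.2 = 0 then ((e.1.1, e.1.2 + 1), 1)
  else if e.2 = 1 then ((e.1.1, e.1.2 - 1), 0)
  else if e.2 = 2 then ((e.1.1 - 1, e.1.2), 3)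
  else ((e.1.1 + 1, e.1.2), 2)

/-- The flip-flop shift operator `S`. -/
noncomputable def GridWalk.shift (n : ℕ) [NeZero n] (ψ : (Fin n × Fin n) × Fin 4 → ℂ) :
    (Fin n × Fin n) × Fin 4 → ℂ :=
  fun e => ψ (GridWalk.flip n e)

/-- The Grover coin `I ⊗ C`. -/
noncomputable def GridWalk.coin (n : ℕ) (ψ : (Fin n × Fin n) × Fin 4 → ℂ) :
    (Fin n × Fin n) × Fin 4 → ℂ :=
  fun e => (1 / 2 : ℂ) * (∑ c' : Fin 4, ψ (e.1, c')) - ψ e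

/-- The query `Q ⊗ I`, flipping the sign at marked vertices. -/
noncomputable def GridWalk.query (n : ℕ) (M : Finset (Fin n × Fin n))
    (ψ : (Fin n × Fin n) × Fin 4 → ℂ) : (Fin n × Fin n) × Fin 4 → ℂ :=
  fun e => if e.1 ∈ M then -ψ e else ψ e

/-- One step of the search algorithm, `U' = S · (I ⊗ C) · (Q ⊗ I)`. -/
noncomputable def GridWalk.step (n : ℕ) [NeZero n] (M : Finset (Fin n × Fin n))
    (ψ : (Fin n × Fin n) × Fin 4 → ℂ) : (Fin n × Fin n) × Fin 4 → ℂ :=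
  GridWalk.shift n (GridWalk.coin n (GridWalk.query n M ψ))

theorem GridWalk.flip_flip (n : ℕ) [NeZero n] (e : (Fin n × Fin n) × Fin 4) :
    GridWalk.flip n (GridWalk.flip n e) = e := by
  obtain ⟨⟨x, y⟩, c⟩ := e
  fin_cases c <;> simp [GridWalk.flip]

theorem GridWalk.nbr_inj (n : ℕ) [NeZero n] (hn : 3 ≤ n) (v : Fin n × Fin n) (c d : Fin 4)
    (h : (GridWalk.flip n (v, c)).1 = (GridWalk.flip n (v, d)).1) : c = d := by
  obtain ⟨x, y⟩ := v
  have h1 : (1 : Fin n) ≠ 0 := by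
    intro h
    have := congrArg Fin.val h
    rw [Fin.val_one', Fin.val_zero, Nat.mod_eq_of_lt (by omega)] at this
    omega
  have h2 : (1 : Fin n) + 1 ≠ 0 := by
    intro h
    have := congrArg Fin.val h
    rw [Fin.val_add, Fin.val_one', Fin.val_zero, Nat.mod_eq_of_lt (a := 1) (by omega),
      Nat.mod_eq_of_lt (by omega)] at this
    omega
  have h3 : ∀ z : Fin n, z + 1 ≠ z - 1 := by
    intro z hz
    apply h2
    have : z + (1 + 1) = z := by rw [← add_assoc, hz, sub_add_cancel]
    exact add_eq_left.mp this
  have h4 : ∀ z : Fin n, z - 1 ≠ z + 1 := fun z => (h3 z).symm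
  fin_cases c <;> fin_cases d <;> simp_all [GridWalk.flip]

theorem GridWalk.exists_unique_dart (n : ℕ) [NeZero n] (hn : 3 ≤ n)
    (P : Finset ((Fin n × Fin n) × (Fin n × Fin n)))
    (hadj : ∀ p ∈ P, ∃ c : Fin 4, (GridWalk.flip n (p.1, c)).1 = p.2)
    (hdisj : ∀ p ∈ P, ∀ q ∈ P, p ≠ q →
      ({p.1, p.2} : Finset (Fin n × Fin n)) ∩ {q.1, q.2} = ∅)
    (v : Fin n × Fin n) (p : (Fin n × Fin n) × (Fin n × Fin n)) (hp : p ∈ P)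
    (hv : v = p.1 ∨ v = p.2) :
    ∃ c₀ : Fin 4, ∀ c : Fin 4, ((v, (GridWalk.flip n (v, c)).1) ∈ P ∨
      ((GridWalk.flip n (v, c)).1, v) ∈ P) ↔ c = c₀ := by
  have huniq : ∀ q ∈ P, (v = q.1 ∨ v = q.2) → q = p := by
    intro q hq hvq
    by_contra hne
    have h := hdisj q hq p hp hne
    have hmem : v ∈ ({q.1, q.2} : Finset (Fin n × Fin n)) ∩ {p.1, p.2} := by
      simp [hvq, hv]
    rw [h] at hmem
    simp at hmem
  obtain ⟨p1, p2⟩ := p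
  obtain ⟨c, hc⟩ := hadj _ hp
  simp only at hc hv
  rcases hv with rfl | rfl
  · refine ⟨c, fun d => ⟨fun hd => ?_, ?_⟩⟩
    · apply GridWalk.nbr_inj n hn v
      rw [hc]
      rcases hd with hd | hd
      · exact (Prod.ext_iff.mp (huniq _ hd (Or.inl rfl))).2
      · have := Prod.ext_iff.mp (huniq _ hd (Or.inr rfl))
        exact this.1.trans this.2
    · rintro rfl
      left
      rw [hc]
      exact hp
  · have hback : (GridWalk.flip n (v, (GridWalk.flip n (p1, c)).2)).1 = p1 := by
      rw [← hc]
      exact congrArg Prod.fst (GridWalk.flip_flip n (p1, c))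
    refine ⟨(GridWalk.flip n (p1, c)).2, fun d => ⟨fun hd => ?_, ?_⟩⟩
    · apply GridWalk.nbr_inj n hn v
      rw [hback]
      rcases hd with hd | hd
      · have := Prod.ext_iff.mp (huniq _ hd (Or.inl rfl))
        exact this.2.trans this.1
      · exact (Prod.ext_iff.mp (huniq _ hd (Or.inr rfl))).1
    · rintro rfl
      right
      rw [hback]
      exact hp

/-- If the marked set `M` of the `n × n` torus grid can be partitioned into pairwise
disjoint pairs of adjacent vertices `P`, then the state with amplitude `-3a` on the two
darts of each pair's shared edge and amplitude `a` on every other dart is fixed by one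
step of the search algorithm. -/
theorem grid_paired_marked_stationary (n : ℕ) [NeZero n] (hn : 3 ≤ n)
    (P : Finset ((Fin n × Fin n) × (Fin n × Fin n)))
    (hadj : ∀ p ∈ P, ∃ c : Fin 4, (GridWalk.flip n (p.1, c)).1 = p.2)
    (hdisj : ∀ p ∈ P, ∀ q ∈ P, p ≠ q →
      ({p.1, p.2} : Finset (Fin n × Fin n)) ∩ {q.1, q.2} = ∅)
    (M : Finset (Fin n × Fin n)) (hM : M = P.biUnion fun p => {p.1, p.2}) (a : ℂ) :
    GridWalk.step n M
      (fun e => if (e.1, (GridWalk.flip n e).1) ∈ P ∨ ((GridWalk.flip n e).1, e.1) ∈ P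
        then -3 * a else a)
    = fun e => if (e.1, (GridWalk.flip n e).1) ∈ P ∨ ((GridWalk.flip n e).1, e.1) ∈ P
        then -3 * a else a := by
  set φ : (Fin n × Fin n) × Fin 4 → ℂ := fun e =>
    if (e.1, (GridWalk.flip n e).1) ∈ P ∨ ((GridWalk.flip n e).1, e.1) ∈ P
      then -3 * a else a with hφ
  have hcoin : ∀ e, GridWalk.coin n (GridWalk.query n M φ) e = φ e := by
    rintro ⟨v, c⟩
    by_cases hv : v ∈ M
    · have hv' := hv
      rw [hM, Finset.mem_biUnion] at hv'
      obtain ⟨p, hp, hvp⟩ := hv'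
      have hvp' : v = p.1 ∨ v = p.2 := by simpa using hvp
      obtain ⟨c₀, hc₀⟩ := GridWalk.exists_unique_dart n hn P hadj hdisj v p hp hvp'
      have hval : ∀ d, φ (v, d) = if d = c₀ then -3 * a else a := by
        intro d
        simp only [hφ, hc₀ d]
      have hsum : ∑ d : Fin 4, φ (v, d) = 0 := by
        simp only [hval]
        fin_cases c₀ <;> simp [Fin.sum_univ_four] <;> ring
      simp only [GridWalk.coin, GridWalk.query, hv, if_true, Finset.sum_neg_distrib, hsum]
      ring
    · have hval : ∀ d, φ (v, d) = a := by
        intro d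
        simp only [hφ]
        rw [if_neg]
        intro h
        apply hv
        rw [hM, Finset.mem_biUnion]
        rcases h with h | h
        · exact ⟨_, h, by simp⟩
        · exact ⟨_, h, by simp⟩
      simp only [GridWalk.coin, GridWalk.query, hv, if_false, hval, Fin.sum_univ_four]
      ring
  funext e
  simp only [GridWalk.step, GridWalk.shift]
  rw [hcoin]
  simp only [hφ, GridWalk.flip_flip]
  simp only [or_comm]
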